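/- Every zero s ∈ ℂ of the function ξ_-(s) = (1/2)(ξ(s+1/2) − ξ(s−1/2)) satisfies Re s = 1/2. -/

import Mathlib

open Complex

/-- The Riemann xi function: `ξ(s) = (s(s-1)/2)·Λ₀(s) + 1/2`. -/
noncomputable def xi (s : ℂ) : ℂ := s * (s - 1) / 2 * completedRiemannZeta₀ s + 1 / 2

/-- `ξ_r = ξ^{(2r)}(1/2) / (2r)!`. -/
noncomputable def xiCoeff (r : ℕ) : ℂ := iteratedDeriv (2 * r) xi (1 / 2) / ((2 * r).factorial : ℂ)

/-- `ξ₊(s) = (1/2)(ξ(s+1/2) + ξ(s−1/2))`. -/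
noncomputable def xiPlus (s : ℂ) : ℂ := (1 / 2) * (xi (s + 1 / 2) + xi (s - 1 / 2))

/-- `ξ₋(s) = (1/2)(ξ(s+1/2) − ξ(s−1/2))`. -/
noncomputable def xiMinus (s : ℂ) : ℂ := (1 / 2) * (xi (s + 1 / 2) - xi (s - 1 / 2))

open MeasureTheory Set Filter Topology Asymptotics

theorem norm_fract_mul_cpow_le (s : ℂ) {t : ℝ} (ht : 1 < t) :
    ‖((Int.fract t : ℝ) : ℂ) * (t : ℂ) ^ (-(s + 1))‖ ≤ t ^ (-(s.re + 1)) := by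
  have ht0 : 0 < t := one_pos.trans ht
  rw [norm_mul, norm_cpow_eq_rpow_re_of_pos ht0, norm_real, Real.norm_eq_abs,
    abs_of_nonneg (Int.fract_nonneg t)]
  simpa using mul_le_of_le_one_left (Real.rpow_nonneg ht0.le _) (Int.fract_lt_one t).le

theorem integrableOn_fract_mul_cpow {s : ℂ} (hs : 0 < s.re) :
    IntegrableOn (fun t : ℝ ↦ ((Int.fract t : ℝ) : ℂ) * (t : ℂ) ^ (-(s + 1))) (Ioi 1) := by
  have hg : IntegrableOn (fun t : ℝ ↦ t ^ (-(s.re + 1))) (Ioi 1) :=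
    integrableOn_Ioi_rpow_of_lt (by linarith) one_pos
  refine Integrable.mono' hg (Measurable.aestronglyMeasurable (by fun_prop)) ?_
  filter_upwards [ae_restrict_mem measurableSet_Ioi] with t ht
  exact norm_fract_mul_cpow_le s ht

theorem norm_integral_fract_mul_cpow_le {s : ℂ} (hs : 0 < s.re) :
    ‖∫ t in Ioi (1 : ℝ), ((Int.fract t : ℝ) : ℂ) * (t : ℂ) ^ (-(s + 1))‖ ≤ 1 / s.re := by
  have hi : ∫ t in Ioi (1 : ℝ), t ^ (-(s.re + 1)) = 1 / s.re := by
    rw [integral_Ioi_rpow_of_lt (by linarith) one_pos, Real.one_rpow,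
      show -(s.re + 1) + 1 = -s.re by ring, neg_div_neg_eq]
  rw [← hi]
  refine norm_integral_le_of_norm_le (integrableOn_Ioi_rpow_of_lt (by linarith) one_pos) ?_
  filter_upwards [ae_restrict_mem measurableSet_Ioi] with t ht
  exact norm_fract_mul_cpow_le s ht

theorem differentiableOn_integral_fract_mul_cpow :
    DifferentiableOn ℂ
      (fun s : ℂ ↦ ∫ t in Ioi (1 : ℝ), ((Int.fract t : ℝ) : ℂ) * (t : ℂ) ^ (-(s + 1)))
      {s | 0 < s.re} := by
  set f : ℝ → ℂ := (Ioi 1).indicator fun t ↦ ((Int.fract t : ℝ) : ℂ) with hf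
  have hbound (t : ℝ) : ‖f t‖ ≤ 1 := by
    by_cases ht : t ∈ Ioi (1 : ℝ)
    · rw [hf, indicator_of_mem ht, norm_real, Real.norm_eq_abs,
        abs_of_nonneg (Int.fract_nonneg t)]
      exact (Int.fract_lt_one t).le
    · simp [hf, indicator_of_notMem ht]
  have hloc : LocallyIntegrable f := by
    refine (locallyIntegrable_const (1 : ℝ)).mono ?_ (ae_of_all _ fun t ↦ by simpa using hbound t)
    exact ((by fun_prop : Measurable fun t : ℝ ↦ ((Int.fract t : ℝ) : ℂ)).indicator
      measurableSet_Ioi).aestronglyMeasurable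
  have htop : f =O[atTop] (fun t : ℝ ↦ t ^ (-(0 : ℝ))) := by
    simpa using IsBigO.of_bound (f := f) (g := fun _ : ℝ ↦ (1 : ℝ)) (l := atTop) 1
      (Eventually.of_forall fun t ↦ by simpa using hbound t)
  have heq (s : ℂ) : ∫ t in Ioi (1 : ℝ), ((Int.fract t : ℝ) : ℂ) * (t : ℂ) ^ (-(s + 1)) =
      mellin f (-s) := by
    rw [mellin, ← integral_indicator measurableSet_Ioi, ← integral_indicator measurableSet_Ioi]
    congr 1
    ext t
    by_cases ht : t ∈ Ioi (1 : ℝ)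
    · have ht' : t ∈ Ioi (0 : ℝ) := one_pos.trans (mem_Ioi.mp ht)
      rw [indicator_of_mem ht, indicator_of_mem ht', hf, indicator_of_mem ht, smul_eq_mul,
        mul_comm, neg_add']
    · rw [indicator_of_notMem ht]
      simp [indicator, hf, notMem_Ioi.mp ht |>.not_gt]
  simp_rw [heq]
  intro s hs
  have hbot : f =O[𝓝[>] 0] (fun t : ℝ ↦ t ^ (-(-s.re - 1))) := by
    refine (isBigO_zero _ _).congr' ?_ EventuallyEq.rfl
    filter_upwards [mem_nhdsWithin_of_mem_nhds (Iio_mem_nhds one_pos)] with t ht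
    rw [hf, indicator_of_notMem (notMem_Ioi.mpr (mem_Iio.mp ht).le)]
  have hs' : 0 < s.re := hs
  have hm := mellin_differentiableAt_of_isBigO_rpow (s := -s) (hloc.locallyIntegrableOn _) htop
    (by simpa using hs') hbot (by simp)
  exact (hm.comp s differentiableAt_id.neg).differentiableWithinAt

theorem riemannZeta₁_eq_of_one_lt_re {s : ℂ} (hs : 1 < s.re) :
    riemannZeta₁ s = s - s * (s - 1) *
      ∫ t in Ioi (1 : ℝ), ((Int.fract t : ℝ) : ℂ) * (t : ℂ) ^ (-(s + 1)) := by
  have hs1 : s ≠ 1 := by rintro rfl; simp at hs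
  have hs1' : s - 1 ≠ 0 := sub_ne_zero.mpr hs1
  have hint : ∫ t in Ioi (1 : ℝ), (∑ _k ∈ Finset.Icc 1 ⌊t⌋₊, (1 : ℂ)) * (t : ℂ) ^ (-(s + 1)) =
      1 / (s - 1) - ∫ t in Ioi (1 : ℝ), ((Int.fract t : ℝ) : ℂ) * (t : ℂ) ^ (-(s + 1)) := by
    have h1 : ∫ t in Ioi (1 : ℝ), (t : ℂ) ^ (-s) = 1 / (s - 1) := by
      rw [integral_Ioi_cpow_of_lt (by simpa using neg_lt_neg hs) one_pos, ofReal_one, one_cpow,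
        show -s + 1 = -(s - 1) by ring, neg_div_neg_eq]
    rw [← h1, ← integral_sub (integrableOn_Ioi_cpow_of_lt (by simpa using neg_lt_neg hs) one_pos)
      (integrableOn_fract_mul_cpow (one_pos.trans hs))]
    refine setIntegral_congr_fun measurableSet_Ioi fun t ht ↦ ?_
    have ht0 : (0 : ℝ) < t := one_pos.trans ht
    have hfl : ((⌊t⌋₊ : ℝ) : ℂ) = t - Int.fract t := by
      rw [← ofReal_sub, Int.self_sub_fract, ← natCast_floor_eq_intCast_floor ht0.le]
    have hc : (t : ℂ) ^ (-s) = t * (t : ℂ) ^ (-(s + 1)) := by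
      rw [show -s = -(s + 1) + 1 by ring, cpow_add _ _ (ofReal_ne_zero.mpr ht0.ne'), cpow_one,
        mul_comm]
    simp only [Finset.sum_const, Nat.card_Icc, add_tsub_cancel_right, nsmul_eq_mul, mul_one]
    rw [hc, ← sub_mul, ← hfl, ofReal_natCast]
  have hL := LSeries_eq_mul_integral' (fun _ ↦ (1 : ℂ)) zero_le_one hs
    (IsBigO.of_bound 1 (Eventually.of_forall fun n ↦ by simp))
  have hz : riemannZeta s = LSeries (fun _ ↦ (1 : ℂ)) s := (LSeries_one_eq_riemannZeta hs).symm
  rw [hint, ← hz, riemannZeta_eq_inv_sub_mul hs1] at hL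
  field_simp at hL
  linear_combination hL

theorem riemannZeta₁_eq_of_re_pos {s : ℂ} (hs : 0 < s.re) :
    riemannZeta₁ s = s - s * (s - 1) *
      ∫ t in Ioi (1 : ℝ), ((Int.fract t : ℝ) : ℂ) * (t : ℂ) ^ (-(s + 1)) := by
  have ho : IsOpen {s : ℂ | 0 < s.re} := isOpen_lt continuous_const continuous_re
  have hd : DifferentiableOn ℂ (fun s : ℂ ↦ s - s * (s - 1) *
      ∫ t in Ioi (1 : ℝ), ((Int.fract t : ℝ) : ℂ) * (t : ℂ) ^ (-(s + 1))) {s | 0 < s.re} :=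
    differentiableOn_id.sub ((differentiableOn_id.mul (differentiableOn_id.sub_const 1)).mul
      differentiableOn_integral_fract_mul_cpow)
  exact (differentiable_riemannZeta₁.differentiableOn.analyticOnNhd
    ho).eqOn_of_preconnected_of_eventuallyEq (hd.analyticOnNhd ho)
    (convex_halfSpace_re_gt 0).isPreconnected (by norm_num : (2 : ℂ) ∈ {s : ℂ | 0 < s.re})
    (eventuallyEq_of_mem ((isOpen_lt continuous_const continuous_re).mem_nhds
      (by norm_num : (1 : ℝ) < (2 : ℂ).re)) fun z hz ↦ riemannZeta₁_eq_of_one_lt_re hz) hs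

theorem norm_riemannZeta₁_le {s : ℂ} (hs : 0 < s.re) :
    ‖riemannZeta₁ s‖ ≤ ‖s‖ * (1 + ‖s - 1‖ / s.re) := by
  rw [riemannZeta₁_eq_of_re_pos hs]
  refine (norm_sub_le _ _).trans ?_
  rw [norm_mul, norm_mul, mul_add, mul_one, ← mul_div_assoc, div_eq_mul_one_div]
  gcongr
  exact norm_integral_fract_mul_cpow_le hs

open ArithmeticFunction in
theorem norm_inv_riemannZeta_le {s : ℂ} (hs : 1 < s.re) :
    ‖(riemannZeta s)⁻¹‖ ≤ ‖riemannZeta s.re‖ := by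
  have hr : 1 < (s.re : ℂ).re := by simpa using hs
  have hinv : (riemannZeta s)⁻¹ = LSeries (fun n ↦ ((moebius n : ℤ) : ℂ)) s := by
    rw [inv_eq_iff_eq_inv, ← LSeries_one_eq_riemannZeta hs]
    exact eq_inv_of_mul_eq_one_left (LSeries_one_mul_Lseries_moebius hs)
  have hsum : ∑' n, ‖LSeries.term 1 s n‖ = ‖riemannZeta s.re‖ := by
    have hterm (n : ℕ) : ((‖LSeries.term 1 s n‖ : ℝ) : ℂ) = LSeries.term 1 s.re n := by
      rcases eq_or_ne n 0 with rfl | hn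
      · simp
      · rw [LSeries.norm_term_eq, if_neg hn, LSeries.term_of_ne_zero hn]
        simp [ofReal_cpow]
    have hc : ((∑' n, ‖LSeries.term 1 s n‖ : ℝ) : ℂ) = riemannZeta s.re := by
      rw [ofReal_tsum, tsum_congr hterm, ← LSeries_one_eq_riemannZeta hr, LSeries]
    rw [← hc, norm_real, Real.norm_of_nonneg (tsum_nonneg fun _ ↦ norm_nonneg _)]
  rw [hinv, ← hsum]
  refine tsum_of_norm_bounded (LSeriesSummable_one_iff.mpr hs).norm.hasSum fun n ↦ ?_
  refine LSeries.norm_term_le s ?_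
  simpa using mod_cast abs_moebius_le_one (n := n)

theorem norm_inv_riemannZeta_one_add_le {w : ℂ} (hw : 0 < w.re) :
    ‖(riemannZeta (1 + w))⁻¹‖ ≤ 2 * (1 + w.re) / w.re := by
  have h1 : ((1 + w.re : ℝ) : ℂ) ≠ 1 := by
    rw [Ne, ofReal_eq_one]; linarith
  have hre : (1 + w).re = 1 + w.re := by simp
  refine (norm_inv_riemannZeta_le (by rw [hre]; linarith)).trans ?_
  have hb := norm_riemannZeta₁_le (s := ((1 + w.re : ℝ) : ℂ)) (by rw [ofReal_re]; linarith)
  have hn : ‖((1 + w.re : ℝ) : ℂ)‖ = 1 + w.re := by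
    rw [norm_real, Real.norm_of_nonneg (by linarith)]
  have hs : ((1 + w.re : ℝ) : ℂ) - 1 = (w.re : ℂ) := by push_cast; ring
  rw [hn, hs, norm_real, Real.norm_of_nonneg hw.le, ofReal_re] at hb
  rw [hre, riemannZeta_eq_inv_sub_mul h1, norm_mul, norm_inv, hs, norm_real,
    Real.norm_of_nonneg hw.le, inv_mul_eq_div]
  gcongr
  refine hb.trans ?_
  have : w.re / (1 + w.re) ≤ 1 := div_le_one_of_le₀ (by linarith) (by linarith)
  nlinarith

theorem norm_betaIntegral_one_half_le {u : ℂ} (hu : 1 ≤ u.re) :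
    ‖betaIntegral u (1 / 2)‖ ≤ 2 := by
  have hint : IntervalIntegrable (fun x : ℝ ↦ (1 - x) ^ (-(1 / 2) : ℝ)) volume 0 1 := by
    have := (intervalIntegral.intervalIntegrable_rpow' (r := -(1 / 2)) (a := 0) (b := 1)
      (by norm_num)).comp_sub_left 1
    simpa using this.symm
  have hval : ∫ x in (0 : ℝ)..1, (1 - x) ^ (-(1 / 2) : ℝ) = 2 := by
    rw [intervalIntegral.integral_comp_sub_left (fun x : ℝ ↦ x ^ (-(1 / 2) : ℝ)),
      integral_rpow (Or.inl (by norm_num))]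
    norm_num
  rw [betaIntegral, ← hval]
  refine intervalIntegral.norm_integral_le_of_norm_le zero_le_one ?_ hint
  have hne : ∀ᵐ x : ℝ, x ≠ 1 := by simp [ae_iff]
  filter_upwards [hne] with x hx1 hx
  have hx' : 0 < 1 - x := sub_pos.mpr (lt_of_le_of_ne hx.2 hx1)
  rw [norm_mul, norm_cpow_eq_rpow_re_of_pos hx.1, ← ofReal_one, ← ofReal_sub,
    norm_cpow_eq_rpow_re_of_pos hx']
  have h2 : ((1 / 2 : ℂ) - (1 : ℝ)).re = -(1 / 2) := by norm_num
  rw [ofReal_one] at h2 ⊢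
  rw [h2]
  exact mul_le_of_le_one_left (Real.rpow_nonneg hx'.le _)
    (Real.rpow_le_one hx.1.le hx.2 (by simpa using hu))

theorem mul_Gammaℝ_eq_mul_betaIntegral {w : ℂ} (hw : 0 < w.re) :
    w * Gammaℝ w = (1 + w) * Gammaℝ (1 + w) * betaIntegral (w / 2 + 1) (1 / 2) := by
  have hw2 : 0 < (w / 2 + 1).re := by
    have : (w / 2 + 1).re = w.re / 2 + 1 := by simp
    rw [this]; linarith
  have hw0 : w / 2 ≠ 0 := by intro h; simp_all
  have hw1 : (1 + w) / 2 ≠ 0 := by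
    intro h
    have : (1 + w).re = 0 := by simp_all
    simp at this; linarith
  have h := Gamma_mul_Gamma_eq_betaIntegral hw2 (t := 1 / 2) (by norm_num)
  rw [Gamma_add_one _ hw0, show w / 2 + 1 + 1 / 2 = (1 + w) / 2 + 1 by ring, Gamma_add_one _ hw1,
    Gamma_one_half_eq] at h
  have hpi : (Real.pi : ℂ) ≠ 0 := ofReal_ne_zero.mpr Real.pi_ne_zero
  have hp : (Real.pi : ℂ) ^ (-w / 2) =
      (Real.pi : ℂ) ^ (-(1 + w) / 2) * (Real.pi : ℂ) ^ (1 / 2 : ℂ) := by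
    rw [← cpow_add _ _ hpi]; congr 1; ring
  rw [Gammaℝ_def, Gammaℝ_def, hp]
  linear_combination 2 * (Real.pi : ℂ) ^ (-(1 + w) / 2) * h

theorem differentiable_xi : Differentiable ℂ xi := by
  unfold xi
  exact ((((differentiable_id.mul (differentiable_id.sub_const 1)).div_const 2).mul
    differentiable_completedZeta₀).add_const _)

theorem xi_one_sub (s : ℂ) : xi (1 - s) = xi s := by
  rw [xi, xi, completedRiemannZeta₀_one_sub]
  ring

theorem xi_eq_mul_riemannZeta₁ {s : ℂ} (hs : 0 < s.re) :
    xi s = s / 2 * Gammaℝ s * riemannZeta₁ s := by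
  rcases eq_or_ne s 1 with rfl | hs1
  · simp [xi, Gammaℝ_one]
  · have hs0 : s ≠ 0 := by rintro rfl; simp at hs
    have hs1' : s - 1 ≠ 0 := sub_ne_zero.mpr hs1
    have hs1'' : 1 - s ≠ 0 := sub_ne_zero.mpr hs1.symm
    have hG : Gammaℝ s ≠ 0 := Gammaℝ_ne_zero_of_re_pos hs
    have h1 : riemannZeta₁ s = (s - 1) * riemannZeta s := by
      rw [riemannZeta_eq_inv_sub_mul hs1, mul_inv_cancel_left₀ hs1']
    rw [h1, riemannZeta_def_of_ne_zero hs0, completedRiemannZeta_eq, xi]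
    field_simp
    ring

theorem riemannZeta₁_ne_zero_of_one_le_re {s : ℂ} (hs : 1 ≤ s.re) : riemannZeta₁ s ≠ 0 := by
  rcases eq_or_ne s 1 with rfl | hs1
  · simp
  · have h := riemannZeta_ne_zero_of_one_le_re hs
    rw [riemannZeta_eq_inv_sub_mul hs1] at h
    exact right_ne_zero_of_mul h

theorem xi_ne_zero_of_one_le_re {s : ℂ} (hs : 1 ≤ s.re) : xi s ≠ 0 := by
  have hs0 : 0 < s.re := by linarith
  rw [xi_eq_mul_riemannZeta₁ hs0]
  refine mul_ne_zero (mul_ne_zero (div_ne_zero ?_ two_ne_zero) (Gammaℝ_ne_zero_of_re_pos hs0))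
    (riemannZeta₁_ne_zero_of_one_le_re hs)
  rintro rfl
  simp at hs0

theorem Gammaℝ_conj (s : ℂ) : Gammaℝ (starRingEnd ℂ s) = starRingEnd ℂ (Gammaℝ s) := by
  have hpi : (Real.pi : ℂ).arg ≠ Real.pi := by
    rw [arg_ofReal_of_nonneg Real.pi_pos.le]
    exact Real.pi_ne_zero.symm
  have h2 : starRingEnd ℂ s / 2 = starRingEnd ℂ (s / 2) := by simp [map_ofNat]
  have h3 : -starRingEnd ℂ s / 2 = starRingEnd ℂ (-s / 2) := by simp [map_ofNat]
  rw [Gammaℝ_def, Gammaℝ_def, h2, h3, Gamma_conj, map_mul, cpow_conj _ _ hpi, conj_ofReal]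

theorem xi_conj_of_re_pos {s : ℂ} (hs : 0 < s.re) :
    xi (starRingEnd ℂ s) = starRingEnd ℂ (xi s) := by
  have hz : riemannZeta₁ (starRingEnd ℂ s) = starRingEnd ℂ (riemannZeta₁ s) := by
    rcases eq_or_ne s 1 with rfl | hs1
    · simp
    · have hs1' : starRingEnd ℂ s ≠ 1 := (map_ne_one_iff _ (starRingEnd ℂ).injective).mpr hs1
      simp [riemannZeta₁, riemannZeta₀, hs1, hs1']
  rw [xi_eq_mul_riemannZeta₁ hs, xi_eq_mul_riemannZeta₁ (by simpa using hs), hz, Gammaℝ_conj]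
  simp [map_ofNat]

/-- The quotient `ξ(w) / ξ(1 + w)`, which is shown to be a contraction on the right half-plane. -/
noncomputable def xiQuotient (w : ℂ) : ℂ := xi w / xi (1 + w)

theorem differentiableAt_xiQuotient {w : ℂ} (hw : 0 ≤ w.re) :
    DifferentiableAt ℂ xiQuotient w :=
  (differentiable_xi w).fun_div
    ((differentiable_xi.comp (differentiable_id.const_add 1)) w)
    (xi_ne_zero_of_one_le_re (by simpa using hw))

theorem diffContOnCl_xiQuotient {U : Set ℂ} (hU : U ⊆ {w | 0 < w.re}) :
    DiffContOnCl ℂ xiQuotient U := by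
  refine DifferentiableOn.diffContOnCl fun w hw ↦
    (differentiableAt_xiQuotient ?_).differentiableWithinAt
  have hc : IsClosed {w : ℂ | 0 ≤ w.re} := isClosed_le continuous_const continuous_re
  exact closure_minimal (hU.trans fun z (hz : 0 < z.re) ↦ hz.le) hc hw

theorem norm_xiQuotient_of_re_eq_zero {w : ℂ} (hw : w.re = 0) : ‖xiQuotient w‖ = 1 := by
  have hconj : 1 - w = starRingEnd ℂ (1 + w) := by
    apply Complex.ext <;> simp [hw]
  have h : ‖xi w‖ = ‖xi (1 + w)‖ := by
    rw [← xi_one_sub w, hconj, xi_conj_of_re_pos (by simp [hw]), norm_conj]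
  rw [xiQuotient, norm_div, h, div_self]
  exact norm_ne_zero_iff.mpr (xi_ne_zero_of_one_le_re (by simp [hw]))

theorem xiQuotient_eq {w : ℂ} (hw : 0 < w.re) :
    xiQuotient w = betaIntegral (w / 2 + 1) (1 / 2) * (riemannZeta₁ w / w) *
      (riemannZeta (1 + w))⁻¹ := by
  have hw0 : w ≠ 0 := by rintro rfl; simp at hw
  have hw1 : 0 < (1 + w).re := by simp; linarith
  have h1w : 1 + w ≠ 0 := by intro h; simp [h] at hw1
  have hG := Gammaℝ_ne_zero_of_re_pos hw1
  have hz1 : riemannZeta₁ (1 + w) ≠ 0 := riemannZeta₁_ne_zero_of_one_le_re (by simp [hw.le])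
  have hz : riemannZeta (1 + w) = w⁻¹ * riemannZeta₁ (1 + w) := by
    rw [riemannZeta_eq_inv_sub_mul (by simpa using hw0), add_sub_cancel_left]
  rw [xiQuotient, xi_eq_mul_riemannZeta₁ hw, xi_eq_mul_riemannZeta₁ hw1, hz, mul_inv, inv_inv]
  have h := mul_Gammaℝ_eq_mul_betaIntegral hw
  generalize betaIntegral (w / 2 + 1) (1 / 2) = b at h ⊢
  field_simp
  linear_combination riemannZeta₁ w * h

theorem norm_xiQuotient_le {w : ℂ} (hw : 0 < w.re) :
    ‖xiQuotient w‖ ≤ 4 * (w.re + ‖w - 1‖) * (1 + w.re) / w.re ^ 2 := by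
  have hw0 : 0 < ‖w‖ := norm_pos_iff.mpr (by rintro rfl; simp at hw)
  have hB : ‖betaIntegral (w / 2 + 1) (1 / 2)‖ ≤ 2 :=
    norm_betaIntegral_one_half_le (by simp; linarith)
  have hZ : ‖riemannZeta₁ w / w‖ ≤ 1 + ‖w - 1‖ / w.re := by
    rw [norm_div, div_le_iff₀' hw0]
    exact norm_riemannZeta₁_le hw
  rw [xiQuotient_eq hw, norm_mul, norm_mul]
  calc _ ≤ 2 * (1 + ‖w - 1‖ / w.re) * (2 * (1 + w.re) / w.re) := by
        gcongr
        exact norm_inv_riemannZeta_one_add_le hw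
    _ = _ := by field_simp; ring

/-- On the half-circle `‖z‖ = R`, the factor `z ^ 2 + R ^ 2` has norm `2 * R * z.re`. -/
theorem norm_sq_add_sq_of_norm_eq {z : ℂ} {R : ℝ} (hz : ‖z‖ = R) (hre : 0 ≤ z.re) :
    ‖z ^ 2 + (R : ℂ) ^ 2‖ = 2 * R * z.re := by
  have h : z ^ 2 + (R : ℂ) ^ 2 = z * ((2 * z.re : ℝ) : ℂ) := by
    rw [← hz, ← mul_conj', ← add_conj]
    ring
  rw [h, norm_mul, hz, norm_real, Real.norm_of_nonneg (by linarith)]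
  ring

theorem norm_xiQuotient_le_of_re_pos {w : ℂ} (hw : 0 < w.re) : ‖xiQuotient w‖ ≤ 192 := by
  set R : ℝ := 2 * ‖w‖ + 1 with hR
  have hR1 : 1 ≤ R := by have := norm_nonneg w; linarith
  set U : Set ℂ := Metric.ball 0 R ∩ {z | 0 < z.re} with hU
  have hUo : IsOpen U := Metric.isOpen_ball.inter (isOpen_lt continuous_const continuous_re)
  have hcl : closure U ⊆ Metric.closedBall 0 R ∩ {z | 0 ≤ z.re} :=
    closure_minimal (inter_subset_inter Metric.ball_subset_closedBall
      fun z (hz : 0 < z.re) ↦ hz.le)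
      (Metric.isClosed_closedBall.inter (isClosed_le continuous_const continuous_re))
  set G : ℂ → ℂ := fun z ↦ (z ^ 2 + (R : ℂ) ^ 2) ^ 2 * xiQuotient z with hG
  have hGd : DiffContOnCl ℂ G U :=
    (by fun_prop : Differentiable ℂ fun z : ℂ ↦ (z ^ 2 + (R : ℂ) ^ 2) ^ 2).diffContOnCl.smul
      (diffContOnCl_xiQuotient inter_subset_right)
  have hfront : ∀ z ∈ frontier U, ‖G z‖ ≤ 96 * R ^ 4 := by
    intro z hz
    rw [hUo.frontier_eq] at hz
    obtain ⟨hzR, hz0⟩ := hcl hz.1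
    have hzR : ‖z‖ ≤ R := by simpa using hzR
    have hz0 : 0 ≤ z.re := hz0
    rw [hG, norm_mul, norm_pow]
    rcases hz0.eq_or_lt with h0 | hpos
    · rw [norm_xiQuotient_of_re_eq_zero h0.symm, mul_one]
      have : ‖z ^ 2 + (R : ℂ) ^ 2‖ ≤ 2 * R ^ 2 := by
        refine (norm_add_le _ _).trans ?_
        rw [norm_pow, norm_pow, norm_real, Real.norm_of_nonneg (by linarith)]
        have := pow_le_pow_left₀ (norm_nonneg z) hzR 2
        linarith
      calc _ ≤ (2 * R ^ 2) ^ 2 := by gcongr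
        _ ≤ 96 * R ^ 4 := by nlinarith [pow_nonneg (zero_le_one.trans hR1) 4]
    · have hzR' : ‖z‖ = R := by
        refine hzR.eq_of_not_lt fun hlt ↦ hz.2 ⟨by simpa using hlt, hpos⟩
      rw [norm_sq_add_sq_of_norm_eq hzR' hz0]
      have hre : z.re ≤ R := (re_le_norm z).trans hzR
      have hz1 : ‖z - 1‖ ≤ R + 1 := (norm_sub_le _ _).trans (by simpa using hzR)
      calc (2 * R * z.re) ^ 2 * ‖xiQuotient z‖
          ≤ (2 * R * z.re) ^ 2 * (4 * (z.re + ‖z - 1‖) * (1 + z.re) / z.re ^ 2) := by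
            gcongr
            exact norm_xiQuotient_le hpos
        _ = 16 * R ^ 2 * (z.re + ‖z - 1‖) * (1 + z.re) := by field_simp; ring
        _ ≤ 16 * R ^ 2 * (3 * R) * (2 * R) := by gcongr <;> linarith
        _ = 96 * R ^ 4 := by ring
  have hwU : w ∈ U := by
    refine ⟨?_, hw⟩
    have := norm_nonneg w
    simp only [Metric.mem_ball, dist_zero_right]
    linarith
  have hGw := norm_le_of_forall_mem_frontier_norm_le
    (Metric.isBounded_ball.subset inter_subset_left) hGd hfront (subset_closure hwU)
  have hlow : 3 / 4 * R ^ 2 ≤ ‖w ^ 2 + (R : ℂ) ^ 2‖ := by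
    have h := norm_sub_le_norm_add ((R : ℂ) ^ 2) (w ^ 2)
    rw [norm_pow, norm_pow, norm_real, Real.norm_of_nonneg (by linarith), add_comm] at h
    nlinarith [norm_nonneg w]
  rw [hG, norm_mul, norm_pow] at hGw
  have hR4 : 0 < R ^ 4 := by positivity
  have hmul : (3 / 4 * R ^ 2) ^ 2 * ‖xiQuotient w‖ ≤ 96 * R ^ 4 := by
    refine le_trans ?_ hGw
    gcongr
  have : R ^ 4 * ‖xiQuotient w‖ ≤ R ^ 4 * 192 := by nlinarith [norm_nonneg (xiQuotient w)]
  exact le_of_mul_le_mul_left this hR4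

theorem norm_xiQuotient_le_one {w : ℂ} (hw : 0 < w.re) : ‖xiQuotient w‖ ≤ 1 := by
  refine PhragmenLindelof.right_half_plane_of_bounded_on_real
    (diffContOnCl_xiQuotient subset_rfl) ⟨0, two_pos, 0, ?_⟩ ?_ (fun x ↦ ?_) hw.le
  · refine IsBigO.of_bound 192 ?_
    filter_upwards [mem_inf_of_right (mem_principal_self _)] with z hz
    simpa using norm_xiQuotient_le_of_re_pos hz
  · refine ⟨192, eventually_map.mpr ?_⟩
    filter_upwards [eventually_gt_atTop 0] with x hx
    exact norm_xiQuotient_le_of_re_pos (by simpa using hx)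
  · exact (norm_xiQuotient_of_re_eq_zero (by simp)).le

theorem norm_xiQuotient_one_lt : ‖xiQuotient 1‖ < 1 := by
  have h1 : xi 1 = 1 / 2 := by simp [xi]
  have h2 : xi 2 = Real.pi / 6 := by
    have hz : riemannZeta₁ 2 = Real.pi ^ 2 / 6 := by
      have := riemannZeta_eq_inv_sub_mul (s := 2) (by norm_num)
      rw [riemannZeta_two] at this
      rw [this]; norm_num
    have hpi : (Real.pi : ℂ) ≠ 0 := ofReal_ne_zero.mpr Real.pi_ne_zero
    rw [xi_eq_mul_riemannZeta₁ (by norm_num), hz, Gammaℝ_def, div_self two_ne_zero, Gamma_one,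
      neg_div, div_self two_ne_zero, cpow_neg_one]
    field_simp
  have h3 : xiQuotient 1 = ((3 / Real.pi : ℝ) : ℂ) := by
    rw [xiQuotient, one_add_one_eq_two, h1, h2]
    push_cast
    field_simp
    norm_num
  rw [h3, norm_real, Real.norm_of_nonneg (by positivity), div_lt_one Real.pi_pos]
  exact Real.pi_gt_three

theorem xiQuotient_ne_one {w : ℂ} (hw : 0 < w.re) : xiQuotient w ≠ 1 := by
  intro h
  have hmax : IsMaxOn (norm ∘ xiQuotient) {z : ℂ | 0 < z.re} w := fun z hz ↦ by
    simpa [h] using norm_xiQuotient_le_one hz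
  have heq := norm_eqOn_of_isPreconnected_of_isMaxOn
    (convex_halfSpace_re_gt 0).isPreconnected (isOpen_lt continuous_const continuous_re)
    (diffContOnCl_xiQuotient subset_rfl).differentiableOn hw hmax
    (by simp : (1 : ℂ) ∈ {z : ℂ | 0 < z.re})
  have : ‖xiQuotient 1‖ = 1 := by simpa [h] using heq
  exact norm_xiQuotient_one_lt.ne this

theorem xi_ne_xi_one_add {w : ℂ} (hw : 0 < w.re) : xi w ≠ xi (1 + w) := fun h ↦
  xiQuotient_ne_one hw <| by
    rw [xiQuotient, h, div_self (xi_ne_zero_of_one_le_re (by simp [hw.le]))]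

/-- Taylor's theorem: every zero of `ξ₋` lies on the critical line `Re s = 1/2`. -/
theorem xiMinus_zeros_on_critical_line :
    ∀ s : ℂ, xiMinus s = 0 → s.re = 1 / 2 := by
  intro s hs
  have h : xi (s + 1 / 2) = xi (s - 1 / 2) := by
    simpa [xiMinus, sub_eq_zero] using hs
  rcases lt_trichotomy s.re (1 / 2) with hlt | heq | hgt
  · refine absurd ?_ (xi_ne_xi_one_add (w := 1 / 2 - s) (by simpa using hlt))
    rw [← xi_one_sub, ← xi_one_sub (1 + (1 / 2 - s))]
    convert h using 2 <;> ring
  · exact heq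
  · refine absurd ?_ (xi_ne_xi_one_add (w := s - 1 / 2) (by simpa using hgt))
    rw [← h]
    congr 1
    ring
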